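/- arXiv:2203.08651 — 2 statements merged into one kernel-verified Lean document; each statement's English description precedes it below -/
import Mathlib

section
/- Let ψ₁, ψ₂, η, α ∈ 𝒦∞ with α(a) ≥ a for all a ≥ 0, ψ₃ ∈ 𝒦, ρ ∈ 𝒫, and θ > δ > 0 be such that ∫_a^{α(a)} ds/ρ(s) ≤ θ − δ for all a > 0. Then there exist β ∈ 𝒦ℒ and γ ∈ 𝒦∞, depending only on these data, with the following property. Let X be a real normed space, t₀ ∈ ℝ, (tᵢ) an impulse time sequence with t_{i+1} − tᵢ ≥ θ for all i ≥ 0 (where t₀ is the initial time), r ≥ 0, and let V_cand: X → [0,∞) be continuous with ψ₁(‖y‖) ≤ V_cand(y) ≤ ψ₂(‖y‖) for all y ∈ X. Let x: [t₀,∞) → X be such that w(t) := V_cand(x(t)) is impulsive-regular and satisfies: (a) D⁺w(t) ≤ −ρ(w(t)) at every non-impulse time t with w(t) ≥ η(r); (b) w(tᵢ) ≤ α(w(tᵢ⁻)) at every impulse time with w(tᵢ⁻) ≥ η(r); (c) w(tᵢ) ≤ ψ₃(r) at every impulse time with w(tᵢ⁻) < η(r). Then ‖x(t)‖ ≤ β(‖x(t₀)‖,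 t − t₀) + γ(r) for all t ≥ t₀. -/
open Filter Topology Set MeasureTheory

noncomputable section

/-- Class 𝒦: continuous, strictly increasing on `[0,∞)`, vanishing at `0`. -/
def ClassK (γ : ℝ → ℝ) : Prop :=
  ContinuousOn γ (Set.Ici 0) ∧ StrictMonoOn γ (Set.Ici 0) ∧ γ 0 = 0

/-- Class 𝒦∞: class 𝒦 and unbounded. -/
def ClassKInf (γ : ℝ → ℝ) : Prop :=
  ClassK γ ∧ Filter.Tendsto γ Filter.atTop Filter.atTop

/-- Class 𝒦ℒ. -/
def ClassKL (β : ℝ → ℝ → ℝ) : Prop :=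
  (∀ s, 0 ≤ s → ClassK (fun r => β r s)) ∧
  (∀ r, 0 ≤ r → AntitoneOn (fun s => β r s) (Set.Ici 0) ∧
    Filter.Tendsto (fun s => β r s) Filter.atTop (nhds 0))

/-- Class 𝒫: continuous, positive definite. -/
def ClassP (φ : ℝ → ℝ) : Prop :=
  ContinuousOn φ (Set.Ici 0) ∧ φ 0 = 0 ∧ ∀ r, 0 < r → 0 < φ r

/-- Upper right Dini derivative `D⁺v(t) = limsup_{s→0⁺} (v(t+s) − v(t))/s`, valued in `EReal`. -/
def DiniUpper (v : ℝ → ℝ) (t : ℝ) : EReal :=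
  Filter.limsup (fun s => (((v (t + s) - v t) / s : ℝ) : EReal)) (nhdsWithin 0 (Set.Ioi 0))

/-- Impulse time sequence with initial time `t₀ = τ 0`: strictly increasing and tending to `∞`;
the impulse times are `τ i` for `i ≥ 1`. -/
def IsImpulseSeq (t₀ : ℝ) (τ : ℕ → ℝ) : Prop :=
  τ 0 = t₀ ∧ StrictMono τ ∧ Filter.Tendsto τ Filter.atTop Filter.atTop

/-- The set `S = {tᵢ : i ≥ 1}` of impulse times. -/
def impulseSet (τ : ℕ → ℝ) : Set ℝ := {s | ∃ i : ℕ, 1 ≤ i ∧ τ i = s}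

/-- Impulsive-regular function on `[t₀,∞)`: right-continuous everywhere, continuous (within
`[t₀,∞)`) at every non-impulse time, and left limits exist at every impulse time. -/
def ImpulsiveRegular (t₀ : ℝ) (τ : ℕ → ℝ) (v : ℝ → ℝ) : Prop :=
  (∀ t, t₀ ≤ t → ContinuousWithinAt v (Set.Ici t) t) ∧
  (∀ t, t₀ ≤ t → t ∉ impulseSet τ → ContinuousWithinAt v (Set.Ici t₀) t) ∧
  (∀ i : ℕ, 1 ≤ i → ∃ L : ℝ, Filter.Tendsto v (nhdsWithin (τ i) (Set.Iio (τ i))) (nhds L))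

lemma exists_F {ρ α : ℝ → ℝ} (hρ : ClassP ρ) {c : ℝ} (hαge : ∀ a, 0 ≤ a → a ≤ α a)
    (hd : ∀ a, 0 < a → (∫ s in a..(α a), (ρ s)⁻¹) ≤ c) :
    ∃ F : ℝ → ℝ, (∀ p, 0 < p → HasDerivAt F (ρ p)⁻¹ p) ∧ StrictMonoOn F (Ioi 0) ∧
      ∀ a, 0 < a → F (α a) ≤ F a + c := by
  obtain ⟨hc, -, hpos⟩ := hρ
  have hcont : ContinuousOn (fun s => (ρ s)⁻¹) (Ioi 0) :=
    (hc.mono Ioi_subset_Ici_self).inv₀ (fun x hx => (hpos x hx).ne')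
  have hint : ∀ a b, 0 < a → 0 < b → IntervalIntegrable (fun s => (ρ s)⁻¹) volume a b := by
    intro a b ha hb
    apply ContinuousOn.intervalIntegrable
    apply hcont.mono
    intro x hx
    exact lt_of_lt_of_le (lt_min ha hb) hx.1
  have hder : ∀ p, 0 < p → HasDerivAt (fun q => ∫ s in (1:ℝ)..q, (ρ s)⁻¹) (ρ p)⁻¹ p := by
    intro p hp
    apply intervalIntegral.integral_hasDerivAt_right (hint 1 p one_pos hp)
    · exact hcont.stronglyMeasurableAtFilter isOpen_Ioi p hp
    · exact hcont.continuousAt (Ioi_mem_nhds hp)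
  refine ⟨fun q => ∫ s in (1:ℝ)..q, (ρ s)⁻¹, hder, ?_, ?_⟩
  · apply strictMonoOn_of_deriv_pos (convex_Ioi 0)
    · intro p hp
      exact (hder p hp).continuousAt.continuousWithinAt
    · intro p hp
      rw [interior_Ioi] at hp
      rw [(hder p hp).deriv]
      exact inv_pos.2 (hpos p hp)
  · intro a ha
    have := intervalIntegral.integral_add_adjacent_intervals (hint 1 a one_pos ha)
      (hint a (α a) ha (ha.trans_le (hαge a ha.le)))
    have h2 := hd a ha
    simp only
    linarith

lemma flow_core {F ρ w : ℝ → ℝ} (hF : ∀ p, 0 < p → HasDerivAt F (ρ p)⁻¹ p)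
    (hFm : StrictMonoOn F (Ioi 0)) (hρ : ∀ p, 0 < p → 0 < ρ p) {a t : ℝ} (hat : a ≤ t)
    (hc : ContinuousOn w (Icc a t)) (hpos : ∀ s ∈ Icc a t, 0 < w s)
    (hD : ∀ s ∈ Ico a t, DiniUpper w s ≤ ((-ρ (w s) : ℝ) : EReal)) :
    F (w t) + (t - a) ≤ F (w a) := by
  have hFc : ContinuousOn F (Ioi 0) := fun p hp => (hF p hp).continuousAt.continuousWithinAt
  have key := image_le_of_liminf_slope_right_le_deriv_boundary (f := fun s => F (w s))
    (B := fun s => F (w a) - (s - a)) (B' := fun _ => -1) (a := a) (b := t)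
    (hFc.comp hc hpos) (by simp) (by fun_prop)
    (fun x _ => by
      have := (((hasDerivAt_id x).sub_const a).const_sub (F (w a))).hasDerivWithinAt (s := Ici x)
      simpa using this)
    ?_ (right_mem_Icc.2 hat)
  · linarith
  intro s hs r hr
  have hws := hpos s ⟨hs.1, hs.2.le⟩
  have hρs := hρ _ hws
  set ε := ρ (w s) * (r + 1) / 2 with hε
  have hεpos : 0 < ε := by
    have : 0 < r + 1 := by linarith
    positivity
  have h1 : ∀ᶠ z in 𝓝[>] (0:ℝ), (w (s + z) - w s) / z < -ρ (w s) + ε := by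
    have : DiniUpper w s < ((-ρ (w s) + ε : ℝ) : EReal) :=
      lt_of_le_of_lt (hD s hs) (EReal.coe_lt_coe_iff.2 (by linarith))
    have h := Filter.eventually_lt_of_limsup_lt this
    filter_upwards [h] with z hz
    exact EReal.coe_lt_coe_iff.1 hz
  have ht : Tendsto (fun z => z - s) (𝓝[>] s) (𝓝[>] (0:ℝ)) := by
    apply tendsto_nhdsWithin_of_tendsto_nhds_of_eventually_within
    · have : Tendsto (fun z => z - s) (𝓝 s) (𝓝 (s - s)) := by
        exact (continuous_id.sub continuous_const).tendsto s
      rw [sub_self] at this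
      exact this.mono_left nhdsWithin_le_nhds
    · filter_upwards [self_mem_nhdsWithin] with z hz
      exact sub_pos.2 (show s < z from hz)
  have h2 := ht.eventually h1
  set L : ℝ → ℝ := fun z => w s + (-ρ (w s) + ε) * (z - s) with hL
  have hLs : L s = w s := by simp [hL]
  have hLd : HasDerivAt L (-ρ (w s) + ε) s := by
    have := (((hasDerivAt_id s).sub_const s).const_mul (-ρ (w s) + ε)).const_add (w s)
    exact this.congr_deriv (mul_one _)
  have hGd : HasDerivAt (fun z => F (L z)) ((ρ (w s))⁻¹ * (-ρ (w s) + ε)) s := by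
    have h := hF (w s) hws
    rw [← hLs] at h
    have := HasDerivAt.comp s h hLd
    rw [hLs] at this
    exact this
  have hval : (ρ (w s))⁻¹ * (-ρ (w s) + ε) < r := by
    have : (ρ (w s))⁻¹ * (-ρ (w s) + ε) = -1 + (r + 1) / 2 := by
      rw [hε]; field_simp
    rw [this]; linarith
  have h3 : ∀ᶠ z in 𝓝[>] s, slope (fun z => F (L z)) s z < r := by
    have := (hasDerivWithinAt_iff_tendsto_slope' (s := Ioi s) (by simp)).1 (hGd.hasDerivWithinAt)
    exact this.eventually_lt_const hval
  have h4 : ∀ᶠ z in 𝓝[>] s, 0 < L z := by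
    have : Tendsto L (𝓝[>] s) (𝓝 (w s)) := by
      have := hLd.continuousAt.tendsto
      rw [hLs] at this
      exact this.mono_left nhdsWithin_le_nhds
    exact this.eventually_const_lt hws
  have h5 : ∀ᶠ z in 𝓝[>] s, z < t := (nhdsWithin_le_nhds) (Iio_mem_nhds hs.2)
  apply Eventually.frequently
  filter_upwards [h2, h3, h4, h5, self_mem_nhdsWithin] with z h2 h3 h4 h5 h6
  have h6 : s < z := h6
  have hz : 0 < z - s := sub_pos.2 h6
  refine lt_of_le_of_lt ?_ h3
  rw [slope_def_field, slope_def_field]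
  apply div_le_div_of_nonneg_right _ hz.le
  rw [div_lt_iff₀ hz] at h2
  have e : s + (z - s) = z := by ring
  rw [e] at h2
  have hle : w z ≤ L z := by simp only [hL]; linarith
  have := hFm.monotoneOn (hpos z ⟨hs.1.trans h6.le, h5.le⟩) h4 hle
  rw [hLs]
  linarith

lemma flow_main {F ρ w : ℝ → ℝ} (hF : ∀ p, 0 < p → HasDerivAt F (ρ p)⁻¹ p)
    (hFm : StrictMonoOn F (Ioi 0)) (hρ : ∀ p, 0 < p → 0 < ρ p) {a t m : ℝ} (hat : a ≤ t)
    (hm : 0 ≤ m)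
    (hc : ContinuousOn w (Icc a t))
    (hD : ∀ s ∈ Ioo a t, m ≤ w s → DiniUpper w s ≤ ((-ρ (w s) : ℝ) : EReal))
    (hwt : m < w t) :
    m < w a ∧ F (w t) + (t - a) ≤ F (w a) := by
  have hFc : ContinuousOn F (Ioi 0) := fun p hp => (hF p hp).continuousAt.continuousWithinAt
  rcases hat.eq_or_lt with rfl | hlt
  · exact ⟨hwt, by simp⟩
  -- core estimate on right-closed subintervals
  have core : ∀ c, a ≤ c → c < t → (∀ s ∈ Ioc c t, m < w s) → ∀ c' ∈ Ioo c t,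
      F (w t) + (t - c') ≤ F (w c') := by
    intro c hac hct h c' hc'
    apply flow_core hF hFm hρ hc'.2.le
    · exact hc.mono (Icc_subset_Icc_left (hac.trans hc'.1.le))
    · intro s hs
      exact hm.trans_lt (h s ⟨hc'.1.trans_le hs.1, hs.2⟩)
    · intro s hs
      exact hD s ⟨hac.trans_lt (hc'.1.trans_le hs.1), hs.2⟩ (h s ⟨hc'.1.trans_le hs.1, hs.2.le⟩).le
  have hlim : ∀ c, a ≤ c → c < t → Tendsto w (𝓝[>] c) (𝓝 (w c)) := by
    intro c hac hct
    have h := hc c ⟨hac, hct.le⟩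
    have h' : ContinuousWithinAt w (Ioc c t) c :=
      h.mono (fun x hx => ⟨hac.trans hx.1.le, hx.2⟩)
    unfold ContinuousWithinAt at h'
    rwa [nhdsWithin_Ioc_eq_nhdsGT hct] at h'
  have hall : ∀ s ∈ Icc a t, m < w s := by
    by_contra hcon
    push Not at hcon
    obtain ⟨s₁, hs₁, hws₁⟩ := hcon
    set A := Icc a t ∩ w ⁻¹' (Iic m) with hA
    have hAc : IsClosed A := hc.preimage_isClosed_of_isClosed isClosed_Icc isClosed_Iic
    have hAk : IsCompact A := isCompact_Icc.of_isClosed_subset hAc inter_subset_left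
    obtain ⟨c, hcA, hcmax⟩ := hAk.exists_isGreatest ⟨s₁, hs₁, hws₁⟩
    have hct : c < t := by
      refine lt_of_le_of_ne hcA.1.2 ?_
      rintro rfl
      exact absurd hcA.2 (not_le.2 hwt)
    have hgt : ∀ s ∈ Ioc c t, m < w s := by
      intro s hs
      by_contra hh
      have : s ∈ A := ⟨⟨hcA.1.1.trans hs.1.le, hs.2⟩, not_lt.1 hh⟩
      exact absurd (hcmax this) (not_le.2 hs.1)
    have hk := core c hcA.1.1 hct hgt
    have : w t ≤ w c := by
      refine ge_of_tendsto (hlim c hcA.1.1 hct) ?_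
      filter_upwards [Ioo_mem_nhdsGT hct] with z hz
      have h1 := hk z hz
      by_contra hh
      push Not at hh
      have h2 := hFm (hm.trans_lt (hgt z ⟨hz.1, hz.2.le⟩)) (hm.trans_lt hwt) hh
      linarith [hz.2]
    have h3 : w c ≤ m := hcA.2
    linarith
  have hwa := hall a (left_mem_Icc.2 hat)
  refine ⟨hwa, ?_⟩
  have hk := core a le_rfl hlt (fun s hs => hall s ⟨hs.1.le, hs.2⟩)
  have hT : Tendsto (fun c => F (w c) - (F (w t) + (t - c))) (𝓝[>] a)
      (𝓝 (F (w a) - (F (w t) + (t - a)))) := by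
    apply Tendsto.sub
    · exact ((hF _ (hm.trans_lt hwa)).continuousAt.tendsto).comp (hlim a le_rfl hlt)
    · have : Continuous (fun c => F (w t) + (t - c)) := by fun_prop
      exact (this.tendsto a).mono_left nhdsWithin_le_nhds
  have := ge_of_tendsto (b := 0) hT (by
    filter_upwards [Ioo_mem_nhdsGT hlt] with z hz
    linarith [hk z hz])
  linarith

/-- averaging operator -/
def avg2 (g : ℝ → ℝ) (r : ℝ) : ℝ := ∫ u in (1:ℝ)..2, g (r * u)

lemma avg2_int {g : ℝ → ℝ} (hg : Monotone g) {r : ℝ} (hr : 0 ≤ r) :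
    IntervalIntegrable (fun u => g (r * u)) volume 1 2 :=
  Monotone.intervalIntegrable (hg.comp (fun _ _ h => mul_le_mul_of_nonneg_left h hr))

lemma le_avg2 {g : ℝ → ℝ} (hg : Monotone g) {r : ℝ} (hr : 0 ≤ r) : g r ≤ avg2 g r := by
  have := intervalIntegral.integral_mono_on (μ := volume) (a := 1) (b := 2) (f := fun _ => g r)
    (by norm_num) (by simp) (avg2_int hg hr) (fun x hx => hg (by nlinarith [hx.1]))
  unfold avg2
  norm_num at this
  exact this

lemma avg2_le {g : ℝ → ℝ} (hg : Monotone g) {r : ℝ} (hr : 0 ≤ r) : avg2 g r ≤ g (2 * r) := by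
  have := intervalIntegral.integral_mono_on (μ := volume) (a := 1) (b := 2)
    (g := fun _ => g (2 * r))
    (by norm_num) (avg2_int hg hr) (by simp) (fun x hx => hg (by nlinarith [hx.2]))
  unfold avg2
  norm_num at this
  exact this

lemma avg2_mono {g : ℝ → ℝ} (hg : Monotone g) : MonotoneOn (avg2 g) (Ici 0) := by
  intro r hr r' hr' h
  exact intervalIntegral.integral_mono_on (by norm_num) (avg2_int hg hr) (avg2_int hg hr')
    (fun x hx => hg (mul_le_mul_of_nonneg_right h (by linarith [hx.1])))

lemma avg2_cont {g : ℝ → ℝ} (hg : Monotone g) (h0 : g 0 = 0)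
    (hs : ∀ ε > 0, ∃ d > 0, g d ≤ ε) : ContinuousOn (avg2 g) (Ici 0) := by
  have hz : avg2 g 0 = 0 := by simp [avg2, h0]
  intro r hr
  rcases (show 0 ≤ r from hr).eq_or_lt with rfl | hr
  · unfold ContinuousWithinAt
    rw [hz, Metric.tendsto_nhdsWithin_nhds]
    intro ε hε
    obtain ⟨d, hd, hgd⟩ := hs (ε / 2) (by linarith)
    refine ⟨d / 2, by linarith, fun {x} hx hxd => ?_⟩
    have hx : 0 ≤ x := hx
    rw [Real.dist_eq, sub_zero, abs_of_nonneg hx] at hxd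
    have h1 : 0 ≤ avg2 g x := by
      refine le_trans ?_ (le_avg2 hg hx)
      rw [← h0]; exact hg hx
    rw [Real.dist_eq, sub_zero, abs_of_nonneg h1]
    have := avg2_le hg hx
    have := hg (show 2 * x ≤ d by linarith)
    linarith
  · apply ContinuousAt.continuousWithinAt
    have hP := intervalIntegral.continuous_primitive (μ := volume) (f := g)
      (fun a b => hg.intervalIntegrable) 0
    have : ContinuousAt (fun r => r⁻¹ * ((∫ x in (0:ℝ)..(r * 2), g x) - ∫ x in (0:ℝ)..(r * 1), g x)) r := by
      apply ContinuousAt.mul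
      · exact continuousAt_inv₀ hr.ne'
      · exact ((hP.comp (continuous_id.mul continuous_const)).sub
          (hP.comp (continuous_id.mul continuous_const))).continuousAt
    refine this.congr ?_
    filter_upwards [Ioi_mem_nhds hr] with x hx
    have hx : 0 < x := hx
    unfold avg2
    rw [intervalIntegral.integral_comp_mul_left _ hx.ne', smul_eq_mul,
      intervalIntegral.integral_interval_sub_left hg.intervalIntegrable hg.intervalIntegrable]

lemma classK_avg2 {g : ℝ → ℝ} (hg : Monotone g) (h0 : g 0 = 0)
    (hs : ∀ ε > 0, ∃ d > 0, g d ≤ ε) {k : ℝ} (hk : 0 < k) :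
    ClassK (fun r => avg2 g r + r * k) := by
  refine ⟨(avg2_cont hg h0 hs).add (by fun_prop), ?_, by simp [avg2, h0]⟩
  intro r hr r' hr' h
  have := avg2_mono hg hr hr' h.le
  have := mul_lt_mul_of_pos_right h hk
  simp only
  linarith

lemma exists_KInf {g : ℝ → ℝ} (hg : Monotone g) (h0 : g 0 = 0)
    (hs : ∀ ε > 0, ∃ d > 0, g d ≤ ε) :
    ∃ γ, ClassKInf γ ∧ ∀ r, 0 ≤ r → g r ≤ γ r := by
  have hn : ∀ r, 0 ≤ r → 0 ≤ avg2 g r := fun r hr => by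
    refine le_trans ?_ (le_avg2 hg hr)
    rw [← h0]; exact hg hr
  refine ⟨_, ⟨classK_avg2 hg h0 hs one_pos, ?_⟩, ?_⟩
  · refine tendsto_atTop_mono' _ ?_ tendsto_id
    filter_upwards [eventually_ge_atTop 0] with r hr
    have := hn r hr
    simp only [id]
    linarith
  · intro r hr
    have := le_avg2 hg hr
    linarith

lemma exists_KL {b : ℝ → ℝ → ℝ} (hb : ∀ s, Monotone (fun R => b R s)) (h0 : ∀ s, b 0 s = 0)
    (ha : ∀ R, Antitone (b R)) (hs : ∀ s, 0 ≤ s → ∀ ε > 0, ∃ d > 0, b d s ≤ ε)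
    (ht : ∀ R, 0 ≤ R → Tendsto (b R) atTop (𝓝 0)) :
    ∃ β, ClassKL β ∧ ∀ R s, 0 ≤ R → 0 ≤ s → b R s ≤ β R s := by
  refine ⟨fun R s => avg2 (fun R => b R s) R + R * Real.exp (-s), ⟨?_, ?_⟩, ?_⟩
  · intro s hs'
    exact classK_avg2 (hb s) (h0 s) (hs s hs') (Real.exp_pos _)
  · intro R hR
    refine ⟨?_, ?_⟩
    · intro s _ s' _ h
      have h1 : avg2 (fun R => b R s') R ≤ avg2 (fun R => b R s) R :=
        intervalIntegral.integral_mono_on (by norm_num) (avg2_int (hb s') hR) (avg2_int (hb s) hR)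
          (fun x hx => ha _ h)
      have h2 : R * Real.exp (-s') ≤ R * Real.exp (-s) :=
        mul_le_mul_of_nonneg_left (Real.exp_le_exp.2 (by linarith)) hR
      simp only
      linarith
    · have h1 : Tendsto (fun s => avg2 (fun R => b R s) R) atTop (𝓝 0) := by
        refine squeeze_zero (fun s => ?_) (fun s => avg2_le (hb s) hR) (ht (2 * R) (by linarith))
        refine le_trans ?_ (le_avg2 (hb s) hR)
        rw [← h0 s]; exact hb s hR
      have h2 : Tendsto (fun s => R * Real.exp (-s)) atTop (𝓝 (R * 0)) :=
        Real.tendsto_exp_neg_atTop_nhds_zero.const_mul R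
      simpa using h1.add h2
  · intro R s hR _
    have h1 : b R s ≤ avg2 (fun R => b R s) R := le_avg2 (hb s) hR
    have h2 := mul_nonneg hR (Real.exp_pos (-s)).le
    linarith

lemma dyn {F ρ α w : ℝ → ℝ} (hF : ∀ p, 0 < p → HasDerivAt F (ρ p)⁻¹ p)
    (hFm : StrictMonoOn F (Ioi 0)) (hρ : ∀ p, 0 < p → 0 < ρ p) {θ δ : ℝ} (hδ : 0 < δ)
    (hθδ : δ < θ) (hα : ClassKInf α) (hαge : ∀ a, 0 ≤ a → a ≤ α a)
    (hFα : ∀ a, 0 < a → F (α a) ≤ F a + (θ - δ))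
    {t₀ : ℝ} {τ : ℕ → ℝ} (hτ : IsImpulseSeq t₀ τ) (hgap : ∀ i : ℕ, θ ≤ τ (i + 1) - τ i)
    {m p : ℝ} (hm : 0 ≤ m) (hreg : ImpulsiveRegular t₀ τ w)
    (ha : ∀ t, t₀ ≤ t → t ∉ impulseSet τ → m ≤ w t →
        DiniUpper w t ≤ (((-ρ (w t)) : ℝ) : EReal))
    (hb : ∀ i : ℕ, 1 ≤ i → m ≤ Function.leftLim w (τ i) →
        w (τ i) ≤ α (Function.leftLim w (τ i)))
    (hc : ∀ i : ℕ, 1 ≤ i → Function.leftLim w (τ i) < m → w (τ i) ≤ p) :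
    ∀ t, t₀ ≤ t → w t ≤ α (max m p) ∨
      (0 < w t ∧ 0 < w t₀ ∧ F (w t) ≤ F (w t₀) - δ / θ * (t - t₀)) := by
  obtain ⟨hτ0, hτm, hτt⟩ := hτ
  obtain ⟨hr1, hr2, hr3⟩ := hreg
  set K := max m p with hK
  have hK0 : 0 ≤ K := hm.trans (le_max_left _ _)
  have hαK : K ≤ α K := hαge K hK0
  have hmK : m ≤ K := le_max_left _ _
  have hpK : p ≤ K := le_max_right _ _
  have hαm := hα.1.2.1.monotoneOn
  have hti : ∀ i, t₀ ≤ τ i := fun i => hτ0 ▸ hτm.monotone (Nat.zero_le i)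
  have hnot : ∀ i s, τ i < s → s < τ (i + 1) → s ∉ impulseSet τ := by
    rintro i s h1 h2 ⟨j, _, rfl⟩
    have := hτm.lt_iff_lt.1 h1
    have := hτm.lt_iff_lt.1 h2
    omega
  -- flow on an interval
  have flow : ∀ i t, τ i ≤ t → t < τ (i + 1) → m < w t →
      m < w (τ i) ∧ F (w t) + (t - τ i) ≤ F (w (τ i)) := by
    intro i t h1 h2 hwt
    apply flow_main hF hFm hρ h1 hm _ _ hwt
    · intro s hs
      rcases hs.1.eq_or_lt with h | h
      · have := hr1 s ((hti i).trans hs.1)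
        exact this.mono (fun x hx => by rw [← h]; exact hx.1)
      · have := hr2 s ((hti i).trans hs.1) (hnot i s h (hs.2.trans_lt h2))
        exact this.mono (fun x hx => (hti i).trans hx.1)
    · intro s hs
      exact ha s ((hti i).trans hs.1.le) (hnot i s hs.1 (hs.2.trans h2))
  have flowL : ∀ i, m < Function.leftLim w (τ (i + 1)) →
      m < w (τ i) ∧ F (Function.leftLim w (τ (i + 1))) + (τ (i + 1) - τ i) ≤ F (w (τ i)) := by
    intro i hL
    obtain ⟨L, hLt⟩ := hr3 (i + 1) (by omega)
    rw [leftLim_eq_of_tendsto hLt] at hL ⊢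
    have hlt : τ i < τ (i + 1) := hτm (Nat.lt_succ_self i)
    have hev : ∀ᶠ s in 𝓝[<] (τ (i + 1)), m < w (τ i) ∧ F (w s) + (s - τ i) ≤ F (w (τ i)) := by
      filter_upwards [Ioo_mem_nhdsLT hlt, hLt.eventually_const_lt hL] with s hs hs2
      exact flow i s hs.1.le hs.2 hs2
    refine ⟨hev.exists.choose_spec.1, ?_⟩
    have hT : Tendsto (fun s => F (w s) + (s - τ i)) (𝓝[<] (τ (i + 1)))
        (𝓝 (F L + (τ (i + 1) - τ i))) := by
      apply Tendsto.add
      · exact ((hF _ (hm.trans_lt hL)).continuousAt.tendsto).comp hLt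
      · have : Continuous (fun c => c - τ i) := by fun_prop
        exact (this.tendsto _).mono_left nhdsWithin_le_nhds
    exact le_of_tendsto hT (hev.mono fun s hs => hs.2)
  have inv : ∀ i : ℕ, w (τ i) ≤ α K ∨
      (0 < w t₀ ∧ F (w (τ i)) ≤ F (w t₀) - (τ i - t₀) + i * (θ - δ)) := by
    intro i
    induction i with
    | zero =>
      rw [hτ0]
      rcases le_or_gt (w t₀) (α K) with h | h
      · exact Or.inl h
      · right
        exact ⟨by linarith, by simp⟩
    | succ i ih =>
      set L := Function.leftLim w (τ (i + 1)) with hL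
      rcases lt_trichotomy L m with h | h | h
      · left
        exact ((hc (i + 1) (by omega) h).trans hpK).trans hαK
      · left
        have := hb (i + 1) (by omega) h.ge
        rw [← hL, h] at this
        exact this.trans (hαm hm hK0 hmK)
      · have hL0 : 0 < L := hm.trans_lt h
        have hj := hb (i + 1) (by omega) h.le
        rw [← hL] at hj
        obtain ⟨hwi, hFL⟩ := flowL i h
        rw [← hL] at hFL
        have hg := hgap i
        rcases ih with ih | ⟨ih0, ih⟩
        · left
          have hK1 : 0 < K := by
            rcases hK0.eq_or_lt with h0 | h0
            · rw [← h0, hα.1.2.2] at ih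
              linarith
            · exact h0
          have h1 : F (w (τ i)) ≤ F (α K) :=
            hFm.monotoneOn (hm.trans_lt hwi) (hK1.trans_le hαK) ih
          have h2 := hFα K hK1
          have hLK : L ≤ K := by
            by_contra hh
            have := hFm hK1 hL0 (not_le.1 hh)
            linarith
          exact hj.trans (hαm hL0.le hK0 hLK)
        · rcases le_or_gt (w (τ (i + 1))) (α K) with h' | h'
          · exact Or.inl h'
          · right
            refine ⟨ih0, ?_⟩
            have hw1 : 0 < w (τ (i + 1)) := by linarith
            have h1 : F (w (τ (i + 1))) ≤ F (α L) :=
              hFm.monotoneOn hw1 (hw1.trans_le hj) hj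
            have h2 := hFα L hL0
            push_cast
            linarith
  have hlen : ∀ i : ℕ, i * θ ≤ τ i - t₀ := by
    intro i
    induction i with
    | zero => simp [hτ0]
    | succ i ih =>
      have := hgap i
      push_cast
      linarith
  intro t ht
  obtain ⟨i, hi1, hi2⟩ : ∃ i, τ i ≤ t ∧ t < τ (i + 1) := by
    have hex : ∃ n, t < τ n := (hτt.eventually_gt_atTop t).exists
    classical
    have hs := Nat.find_spec hex
    have hn : Nat.find hex ≠ 0 := by
      intro h
      rw [h, hτ0] at hs
      linarith
    obtain ⟨k, hk⟩ := Nat.exists_eq_succ_of_ne_zero hn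
    refine ⟨k, not_lt.1 (Nat.find_min hex (by omega)), ?_⟩
    rw [hk] at hs
    exact hs
  rcases le_or_gt (w t) (α K) with h | h
  · exact Or.inl h
  · right
    have hwt : m < w t := by linarith
    obtain ⟨hwi, hFt⟩ := flow i t hi1 hi2 hwt
    have h0 : 0 < w t := hm.trans_lt hwt
    rcases inv i with hi | ⟨hw0, hi⟩
    · exfalso
      have hlt := hFm (hm.trans_lt hwi) h0 (hi.trans_lt h)
      linarith
    · refine ⟨h0, hw0, ?_⟩
      have hθ : 0 < θ := hδ.trans hθδ
      have h1 : i * (θ - δ) ≤ (t - t₀) * ((θ - δ) / θ) := by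
        have h2 : (i:ℝ) ≤ (t - t₀) / θ := by
          rw [le_div_iff₀ hθ]
          linarith [hlen i]
        calc (i:ℝ) * (θ - δ) ≤ (t - t₀) / θ * (θ - δ) :=
              mul_le_mul_of_nonneg_right h2 (by linarith)
          _ = _ := by ring
      have h3 : (t - t₀) * ((θ - δ) / θ) = (t - t₀) - δ / θ * (t - t₀) := by
        field_simp
      linarith

/-- generalized inverse -/
def gInv (ψ : ℝ → ℝ) (A : ℝ) : ℝ := sSup {y | 0 ≤ y ∧ ψ y ≤ A}

lemma gInv_bdd {ψ : ℝ → ℝ} (hψ : ClassKInf ψ) (A : ℝ) : BddAbove {y | 0 ≤ y ∧ ψ y ≤ A} := by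
  obtain ⟨Y, hY⟩ := ((hψ.2.eventually_gt_atTop A).and (eventually_ge_atTop 0)).exists_forall_of_atTop
  refine ⟨Y, fun y hy => ?_⟩
  by_contra hh
  have := (hY y (not_le.1 hh).le).1
  linarith [hy.2]

lemma classK_pos {ψ : ℝ → ℝ} (hψ : ClassK ψ) {y : ℝ} (hy : 0 < y) : 0 < ψ y := by
  have := hψ.2.1 (self_mem_Ici) hy.le hy
  rwa [hψ.2.2] at this

lemma classK_nonneg {ψ : ℝ → ℝ} (hψ : ClassK ψ) {y : ℝ} (hy : 0 ≤ y) : 0 ≤ ψ y := by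
  have := hψ.2.1.monotoneOn (self_mem_Ici) hy hy
  rwa [hψ.2.2] at this

lemma classK_small {ψ : ℝ → ℝ} (hψ : ClassK ψ) {ε : ℝ} (hε : 0 < ε) :
    ∃ d > 0, ∀ x, 0 ≤ x → x ≤ d → ψ x < ε := by
  have h := hψ.1 0 self_mem_Ici
  unfold ContinuousWithinAt at h
  rw [hψ.2.2, Metric.tendsto_nhdsWithin_nhds] at h
  obtain ⟨d, hd, h⟩ := h ε hε
  refine ⟨d / 2, by linarith, fun x hx hxd => ?_⟩
  have := h (show x ∈ Ici 0 from hx) (by rw [Real.dist_eq, sub_zero, abs_of_nonneg hx]; linarith)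
  rw [Real.dist_eq, sub_zero] at this
  exact (le_abs_self _).trans_lt this

lemma gInv_ne {ψ : ℝ → ℝ} (hψ : ClassKInf ψ) {A : ℝ} (hA : 0 ≤ A) :
    {y | 0 ≤ y ∧ ψ y ≤ A}.Nonempty := ⟨0, le_rfl, by rw [hψ.1.2.2]; exact hA⟩

lemma le_gInv {ψ : ℝ → ℝ} (hψ : ClassKInf ψ) {A y : ℝ} (hy : 0 ≤ y) (h : ψ y ≤ A) :
    y ≤ gInv ψ A := le_csSup (gInv_bdd hψ A) ⟨hy, h⟩

lemma gInv_mono {ψ : ℝ → ℝ} (hψ : ClassKInf ψ) {A B : ℝ} (hA : 0 ≤ A) (h : A ≤ B) :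
    gInv ψ A ≤ gInv ψ B := by
  apply csSup_le_csSup (gInv_bdd hψ B) (gInv_ne hψ hA)
  exact fun y hy => ⟨hy.1, hy.2.trans h⟩

lemma gInv_le {ψ : ℝ → ℝ} (hψ : ClassKInf ψ) {A ε : ℝ} (hA : 0 ≤ A) (hε : 0 ≤ ε)
    (h : A ≤ ψ ε) : gInv ψ A ≤ ε := by
  apply csSup_le (gInv_ne hψ hA)
  intro y hy
  by_contra hh
  have := hψ.1.2.1 hε hy.1 (not_le.1 hh)
  linarith [hy.2]

lemma gInv_zero {ψ : ℝ → ℝ} (hψ : ClassKInf ψ) : gInv ψ 0 = 0 :=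
  le_antisymm (gInv_le hψ le_rfl le_rfl hψ.1.2.2.ge) (le_gInv hψ le_rfl hψ.1.2.2.le)

lemma exists_gamma {ψ₁ α η ψ₃ : ℝ → ℝ} (hψ₁ : ClassKInf ψ₁) (hα : ClassKInf α)
    (hη : ClassKInf η) (hψ₃ : ClassK ψ₃) :
    ∃ γ, ClassKInf γ ∧ ∀ r y, 0 ≤ r → 0 ≤ y → ψ₁ y ≤ α (max (η r) (ψ₃ r)) → y ≤ γ r := by
  have hk : ∀ r, 0 ≤ r → 0 ≤ max (η r) (ψ₃ r) := fun r hr =>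
    (classK_nonneg hη.1 hr).trans (le_max_left _ _)
  have key : ∃ γ, ClassKInf γ ∧ ∀ r, 0 ≤ r →
      gInv ψ₁ (α (max (η (max r 0)) (ψ₃ (max r 0)))) ≤ γ r := by
    refine exists_KInf
      (g := fun r => gInv ψ₁ (α (max (η (max r 0)) (ψ₃ (max r 0))))) ?_ ?_ ?_
    · intro r r' h
      have hr : 0 ≤ max r 0 := le_max_right _ _
      have hr' : 0 ≤ max r' 0 := le_max_right _ _
      have hmm : max r 0 ≤ max r' 0 := max_le_max_right 0 h
      apply gInv_mono hψ₁ (classK_nonneg hα.1 (hk _ hr))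
      apply hα.1.2.1.monotoneOn (hk _ hr) (hk _ hr')
      exact max_le_max (hη.1.2.1.monotoneOn hr hr' hmm) (hψ₃.2.1.monotoneOn hr hr' hmm)
    · simp [hη.1.2.2, hψ₃.2.2, hα.1.2.2, gInv_zero hψ₁]
    · intro ε hε
      obtain ⟨d₁, hd₁, h₁⟩ := classK_small hα.1 (classK_pos hψ₁.1 hε)
      obtain ⟨d₂, hd₂, h₂⟩ := classK_small hη.1 hd₁
      obtain ⟨d₃, hd₃, h₃⟩ := classK_small hψ₃ hd₁
      refine ⟨min d₂ d₃, lt_min hd₂ hd₃, ?_⟩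
      have hd : 0 ≤ min d₂ d₃ := (lt_min hd₂ hd₃).le
      simp only [max_eq_left hd]
      apply gInv_le hψ₁ (classK_nonneg hα.1 (hk _ hd)) hε.le
      exact (h₁ _ (hk _ hd) (max_le (h₂ _ hd (min_le_left _ _)).le
        (h₃ _ hd (min_le_right _ _)).le)).le
  obtain ⟨γ, hγ, h⟩ := key
  refine ⟨γ, hγ, fun r y hr hy hle => ?_⟩
  refine le_trans ?_ (h r hr)
  simp only [max_eq_left hr]
  exact le_gInv hψ₁ hy hle

lemma exists_beta {ψ₁ ψ₂ F : ℝ → ℝ} (hψ₁ : ClassKInf ψ₁) (hψ₂ : ClassKInf ψ₂)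
    (hFm : StrictMonoOn F (Ioi 0)) {c : ℝ} (hc : 0 < c) :
    ∃ β, ClassKL β ∧ (∀ R s, 0 ≤ R → 0 ≤ s → 0 ≤ β R s) ∧
      ∀ R s y, 0 ≤ R → 0 ≤ s → 0 < y → ψ₁ y ≤ ψ₂ R →
        F (ψ₁ y) ≤ F (ψ₂ R) - c * s → y ≤ β R s := by
  set T : ℝ → ℝ → Set ℝ := fun R s => {y | 0 ≤ y ∧ ψ₁ y ≤ ψ₂ (max R 0) ∧
    (0 < y → F (ψ₁ y) ≤ F (ψ₂ (max R 0)) - c * s)} with hT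
  have hn : ∀ R, 0 ≤ ψ₂ (max R 0) := fun R => classK_nonneg hψ₂.1 (le_max_right _ _)
  have hbdd : ∀ R s, BddAbove (T R s) := fun R s =>
    (gInv_bdd hψ₁ (ψ₂ (max R 0))).mono
      (fun y (hy : y ∈ T R s) => (⟨hy.1, hy.2.1⟩ : 0 ≤ y ∧ ψ₁ y ≤ ψ₂ (max R 0)))
  have h0T : ∀ R s, (0:ℝ) ∈ T R s := fun R s =>
    ⟨le_rfl, by rw [hψ₁.1.2.2]; exact hn R, fun h => absurd h (lt_irrefl _)⟩
  have hb0 : ∀ R s, 0 ≤ sSup (T R s) := fun R s => le_csSup (hbdd R s) (h0T R s)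
  have hbg : ∀ R s, sSup (T R s) ≤ gInv ψ₁ (ψ₂ (max R 0)) := fun R s =>
    csSup_le_csSup (gInv_bdd hψ₁ _) ⟨0, h0T R s⟩
      (fun y (hy : y ∈ T R s) => (⟨hy.1, hy.2.1⟩ : 0 ≤ y ∧ ψ₁ y ≤ ψ₂ (max R 0)))
  have key : ∃ β, ClassKL β ∧ ∀ R s, 0 ≤ R → 0 ≤ s → sSup (T R s) ≤ β R s := by
    refine exists_KL (b := fun R s => sSup (T R s)) ?_ ?_ ?_ ?_ ?_
    · intro s R R' hRR
      apply csSup_le_csSup (hbdd R' s) ⟨0, h0T R s⟩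
      intro y hy
      have hle : ψ₂ (max R 0) ≤ ψ₂ (max R' 0) :=
        hψ₂.1.2.1.monotoneOn (le_max_right R 0) (le_max_right R' 0) (max_le_max_right 0 hRR)
      refine ⟨hy.1, hy.2.1.trans hle, fun hy0 => ?_⟩
      have hp : 0 < ψ₂ (max R 0) := (classK_pos hψ₁.1 hy0).trans_le hy.2.1
      have := hFm.monotoneOn hp (hp.trans_le hle) hle
      have := hy.2.2 hy0
      linarith
    · intro s
      refine le_antisymm ?_ (hb0 0 s)
      have := hbg 0 s
      rwa [max_self, hψ₂.1.2.2, gInv_zero hψ₁] at this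
    · intro R s s' hss
      apply csSup_le_csSup (hbdd R s) ⟨0, h0T R s'⟩
      intro y hy
      refine ⟨hy.1, hy.2.1, fun hy0 => ?_⟩
      have := hy.2.2 hy0
      have := mul_le_mul_of_nonneg_left hss hc.le
      linarith
    · intro s _ ε hε
      obtain ⟨d, hd, h⟩ := classK_small hψ₂.1 (classK_pos hψ₁.1 hε)
      refine ⟨d, hd, (hbg d s).trans ?_⟩
      rw [max_eq_left hd.le]
      exact gInv_le hψ₁ (classK_nonneg hψ₂.1 hd.le) hε.le (h d hd.le le_rfl).le
    · intro R hR
      rw [Metric.tendsto_atTop]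
      intro ε hε
      have hε2 : 0 < ε / 2 := by linarith
      refine ⟨(F (ψ₂ (max R 0)) - F (ψ₁ (ε / 2))) / c + 1, fun s hs => ?_⟩
      rw [Real.dist_eq, sub_zero, abs_of_nonneg (hb0 R s)]
      refine lt_of_le_of_lt ?_ (half_lt_self hε)
      apply csSup_le ⟨0, h0T R s⟩
      intro y hy
      by_contra hh
      have hy2 := not_le.1 hh
      have hy0 := hε2.trans hy2
      have h1 := hy.2.2 hy0
      have h2 := hFm (classK_pos hψ₁.1 hε2) (classK_pos hψ₁.1 hy0)
        (hψ₁.1.2.1 hε2.le hy.1 hy2)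
      have h3 : (F (ψ₂ (max R 0)) - F (ψ₁ (ε / 2))) / c < s := by linarith
      rw [div_lt_iff₀ hc] at h3
      linarith
  obtain ⟨β, hβ, h⟩ := key
  refine ⟨β, hβ, fun R s hR hs => (hb0 R s).trans (h R s hR hs), ?_⟩
  intro R s y hR hs hy h1 h2
  refine le_trans ?_ (h R s hR hs)
  apply le_csSup (hbdd R s)
  refine ⟨hy.le, ?_, fun _ => ?_⟩ <;> rw [max_eq_left hR] <;> assumption

universe u

/-- dwell-time ISS theorem for stable flows and unstable jumps (trajectory-wise):
a candidate ISS-Lyapunov function with dwell-time condition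
`∫_a^{α(a)} ds/ρ(s) ≤ θ − δ` and impulse gaps `≥ θ` yields the ISS estimate. -/
theorem dwellTimeISSStableFlow
    (ψ₁ ψ₂ η α : ℝ → ℝ) (hψ₁ : ClassKInf ψ₁) (hψ₂ : ClassKInf ψ₂)
    (hη : ClassKInf η) (hα : ClassKInf α) (hαge : ∀ a, 0 ≤ a → a ≤ α a)
    (ψ₃ : ℝ → ℝ) (hψ₃ : ClassK ψ₃)
    (ρ : ℝ → ℝ) (hρ : ClassP ρ)
    (θ δ : ℝ) (hδ : 0 < δ) (hθδ : δ < θ)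
    (hdwellint : ∀ a, 0 < a → (∫ s in a..(α a), (ρ s)⁻¹) ≤ θ - δ) :
    ∃ β : ℝ → ℝ → ℝ, ∃ γ : ℝ → ℝ, ClassKL β ∧ ClassKInf γ ∧
      ∀ (X : Type u) [NormedAddCommGroup X] [NormedSpace ℝ X],
      ∀ (t₀ : ℝ) (τ : ℕ → ℝ), IsImpulseSeq t₀ τ →
      (∀ i : ℕ, θ ≤ τ (i + 1) - τ i) →
      ∀ r : ℝ, 0 ≤ r →
      ∀ Vc : X → ℝ, Continuous Vc →
      (∀ y : X, ψ₁ ‖y‖ ≤ Vc y ∧ Vc y ≤ ψ₂ ‖y‖) →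
      ∀ x : ℝ → X,
      ImpulsiveRegular t₀ τ (fun t => Vc (x t)) →
      (∀ t, t₀ ≤ t → t ∉ impulseSet τ → η r ≤ Vc (x t) →
        DiniUpper (fun s => Vc (x s)) t ≤ (((-ρ (Vc (x t))) : ℝ) : EReal)) →
      (∀ i : ℕ, 1 ≤ i → η r ≤ Function.leftLim (fun s => Vc (x s)) (τ i) →
        Vc (x (τ i)) ≤ α (Function.leftLim (fun s => Vc (x s)) (τ i))) →
      (∀ i : ℕ, 1 ≤ i → Function.leftLim (fun s => Vc (x s)) (τ i) < η r →
        Vc (x (τ i)) ≤ ψ₃ r) →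
      ∀ t, t₀ ≤ t → ‖x t‖ ≤ β ‖x t₀‖ (t - t₀) + γ r := by
  obtain ⟨F, hF, hFm, hFα⟩ := exists_F hρ hαge hdwellint
  have hθ : 0 < θ := hδ.trans hθδ
  obtain ⟨γ, hγ, hγ'⟩ := exists_gamma hψ₁ hα hη hψ₃
  obtain ⟨β, hβ, hβ0, hβ'⟩ := exists_beta hψ₁ hψ₂ hFm (div_pos hδ hθ)
  refine ⟨β, γ, hβ, hγ, ?_⟩
  intro X _ _ t₀ τ hτ hgap r hr Vc _ hV x hreg ha hb hc t ht
  have hs : 0 ≤ t - t₀ := sub_nonneg.2 ht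
  have hβn := hβ0 ‖x t₀‖ (t - t₀) (norm_nonneg _) hs
  have hγn := classK_nonneg hγ.1 hr
  rcases (norm_nonneg (x t)).eq_or_lt with h0 | h0
  · rw [← h0]
    linarith
  rcases dyn hF hFm hρ.2.2 hδ hθδ hα hαge hFα hτ hgap (classK_nonneg hη.1 hr) hreg ha hb hc t ht
    with h | ⟨hw, hw0, h⟩
  · have := hγ' r ‖x t‖ hr h0.le ((hV (x t)).1.trans h)
    linarith
  · have hp := classK_pos hψ₁.1 h0
    have h1 := hFm.monotoneOn hp hw (hV (x t)).1
    have h2 := hFm.monotoneOn hw0 (hw0.trans_le (hV (x t₀)).2) (hV (x t₀)).2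
    have h3 : F (ψ₁ ‖x t‖) ≤ F (ψ₂ ‖x t₀‖) - δ / θ * (t - t₀) := by linarith
    have h4 : ψ₁ ‖x t‖ ≤ ψ₂ ‖x t₀‖ := by
      by_contra hh
      have := hFm (hw0.trans_le (hV (x t₀)).2) hp (not_le.1 hh)
      have := mul_nonneg (div_pos hδ hθ).le hs
      linarith
    have := hβ' ‖x t₀‖ (t - t₀) ‖x t‖ (norm_nonneg _) hs h0 h4 h3
    linarith
end
end

section
/- Let ψ₁, ψ₂, η ∈ 𝒦∞, ψ₃ ∈ 𝒦, let ρ: [0,∞) → ℝ satisfy −ρ ∈ 𝒫 and ∫₀¹ ds/(−ρ(s)) = ∞, let α ∈ 𝒦∞, and let θ, δ > 0 be such that ∫_{α(a)}^a ds/(−ρ(s)) ≥ θ + δ for all a > 0. Then there exist β ∈ 𝒦ℒ and γ ∈ 𝒦∞, depending only on these data, with the following property. Let X be a real normed space, t₀ ∈ ℝ, (tᵢ) an impulse time sequence with t_{i+1} − tᵢ ≤ θ for all i ≥ 0 (where t₀ is the initial time), r ≥ 0, and let V_cand: X → [0,∞) be continuous with ψ₁(‖y‖) ≤ V_cand(y)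 ≤ ψ₂(‖y‖) for all y ∈ X. Let x: [t₀,∞) → X be such that w(t) := V_cand(x(t)) is impulsive-regular and satisfies: (a) D⁺w(t) ≤ −ρ(w(t)) at every non-impulse time t with w(t) ≥ η(r); (b) w(tᵢ) ≤ α(w(tᵢ⁻)) at every impulse time with w(tᵢ⁻) ≥ η(r); (c) w(tᵢ) ≤ ψ₃(r) at every impulse time with w(tᵢ⁻) < η(r). Then ‖x(t)‖ ≤ β(‖x(t₀)‖, t − t₀) + γ(r) for all t ≥ t₀. -/
open Filter Topology Set MeasureTheory

noncomputable section

universe u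


lemma exists_inv_aux (g : ℝ → ℝ) (hg : ClassKInf g) :
    ∃ h : ℝ → ℝ, ClassKInf h ∧ (∀ x, 0 ≤ x → h (g x) = x) ∧ (∀ y, 0 ≤ y → g (h y) = y) ∧
      ∀ y, 0 ≤ y → 0 ≤ h y := by
  obtain ⟨⟨hc, hm, h0⟩, ht⟩ := hg
  set G : ℝ → ℝ := fun x => g (max x 0) + min x 0 with hG
  have hGc : Continuous G := by
    have : Continuous (fun x : ℝ => g (max x 0)) :=
      hc.comp_continuous (by fun_prop) (fun x => mem_Ici.2 (le_max_right _ _))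
    exact this.add (by fun_prop)
  have hGpos : ∀ x, 0 ≤ x → G x = g x := fun x hx => by simp [hG, hx]
  have hGneg : ∀ x, x ≤ 0 → G x = x := fun x hx => by simp [hG, hx, h0]
  have hGm : StrictMono G := by
    intro x y hxy
    rcases le_total 0 x with hx | hx
    · rw [hGpos x hx, hGpos y (hx.trans hxy.le)]
      exact hm hx (hx.trans hxy.le) hxy
    · rcases le_total y 0 with hy | hy
      · rwa [hGneg x hx, hGneg y hy]
      · rw [hGneg x hx, hGpos y hy]
        have : g 0 ≤ g y := hm.monotoneOn self_mem_Ici hy hy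
        rcases hx.lt_or_eq with h | h
        · linarith
        · subst h
          have : g 0 < g y := hm self_mem_Ici hy hxy
          linarith
  have hGs : Function.Surjective G := by
    apply hGc.surjective
    · refine ht.congr' ?_
      filter_upwards [eventually_ge_atTop 0] with x hx using (hGpos x hx).symm
    · refine tendsto_id.congr' ?_
      filter_upwards [eventually_le_atBot 0] with x hx using (hGneg x hx).symm
  let e : ℝ ≃o ℝ := hGm.orderIsoOfSurjective G hGs
  have he : ∀ x, e x = G x := fun x => rfl
  have hs0 : e.symm 0 = 0 := by
    rw [OrderIso.symm_apply_eq, he, hGneg 0 le_rfl]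
  have hsn : ∀ y, 0 ≤ y → 0 ≤ e.symm y := fun y hy => by
    rw [← hs0]; exact e.symm.monotone hy
  refine ⟨e.symm, ⟨⟨e.symm.continuous.continuousOn, e.symm.strictMono.strictMonoOn _, hs0⟩,
    e.symm.tendsto_atTop⟩, ?_, ?_, hsn⟩
  · intro x hx
    rw [OrderIso.symm_apply_eq, he, hGpos x hx]
  · intro y hy
    rw [← hGpos _ (hsn y hy), ← he, e.apply_symm_apply]

lemma exists_F_aux (ρ : ℝ → ℝ) (hρ : ClassP (fun s => -ρ s))
    (α : ℝ → ℝ) (hα : ClassKInf α) (c : ℝ) (hc : 0 < c)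
    (hjumpint : ∀ a, 0 < a → c ≤ ∫ s in (α a)..a, (-ρ s)⁻¹) :
    ∃ F E : ℝ → ℝ, (∀ q, 0 < q → HasDerivAt F (-ρ q)⁻¹ q) ∧ StrictMonoOn F (Ioi 0) ∧
      (∀ y, 0 < E y) ∧ (∀ y, F (E y) = y) ∧ (∀ q, 0 < q → E (F q) = q) ∧ Continuous E ∧
      StrictMono E ∧ (∀ a, 0 < a → F (α a) + c ≤ F a) ∧
      (∀ a, 0 < a → 0 < α a ∧ α a < a) := by
  obtain ⟨hρc, hρ0, hρp⟩ := hρ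
  have hcont : ContinuousOn (fun s => (-ρ s)⁻¹) (Ioi 0) :=
    (hρc.mono Ioi_subset_Ici_self).inv₀ (fun x hx => (hρp x hx).ne')
  have hint : ∀ a b : ℝ, 0 < a → 0 < b → IntervalIntegrable (fun s => (-ρ s)⁻¹) volume a b := by
    intro a b ha hb
    apply ContinuousOn.intervalIntegrable
    refine hcont.mono ?_
    intro x hx
    exact lt_of_lt_of_le (lt_min ha hb) hx.1
  set F : ℝ → ℝ := fun q => ∫ s in (1:ℝ)..q, (-ρ s)⁻¹ with hF
  have hd : ∀ q, 0 < q → HasDerivAt F (-ρ q)⁻¹ q := by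
    intro q hq
    exact intervalIntegral.integral_hasDerivAt_right (hint 1 q one_pos hq)
      (hcont.stronglyMeasurableAtFilter isOpen_Ioi q hq) (hcont.continuousAt (Ioi_mem_nhds hq))
  have hFc : ContinuousOn F (Ioi 0) := fun q hq => (hd q hq).continuousAt.continuousWithinAt
  have hFm : StrictMonoOn F (Ioi 0) := by
    apply strictMonoOn_of_deriv_pos (convex_Ioi 0) hFc
    intro x hx
    rw [interior_Ioi] at hx
    rw [(hd x hx).deriv]
    exact inv_pos.mpr (hρp x hx)
  have hαp : ∀ a, 0 < a → 0 < α a := by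
    intro a ha
    have := hα.1.2.1 (self_mem_Ici) (mem_Ici.2 ha.le) ha
    rwa [hα.1.2.2] at this
  have hj : ∀ a, 0 < a → F (α a) + c ≤ F a := by
    intro a ha
    have h1 := hjumpint a ha
    have h2 := intervalIntegral.integral_interval_sub_left (hint 1 a one_pos ha)
      (hint 1 (α a) one_pos (hαp a ha))
    simp only [hF]
    linarith
  have hαlt : ∀ a, 0 < a → α a < a := by
    intro a ha
    rw [← hFm.lt_iff_lt (hαp a ha) ha]
    linarith [hj a ha]
  obtain ⟨αi, hαi, hl, hr, hn⟩ := exists_inv_aux α hα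
  have hlow : ∀ n : ℕ, ∃ q, 0 < q ∧ F q ≤ F 1 - n * c := by
    intro n
    induction n with
    | zero => exact ⟨1, one_pos, by simp⟩
    | succ n ih =>
      obtain ⟨q, hq, h⟩ := ih
      refine ⟨α q, hαp q hq, ?_⟩
      have := hj q hq
      push_cast
      linarith
  have hup : ∀ n : ℕ, ∃ q, 0 < q ∧ F 1 + n * c ≤ F q := by
    intro n
    induction n with
    | zero => exact ⟨1, one_pos, by simp⟩
    | succ n ih =>
      obtain ⟨q, hq, h⟩ := ih
      have hp : 0 < αi q := by
        refine lt_of_le_of_ne (hn q hq.le) ?_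
        intro h
        have := hr q hq.le
        rw [← h, hα.1.2.2] at this
        linarith
      refine ⟨αi q, hp, ?_⟩
      have := hj _ hp
      rw [hr q hq.le] at this
      push_cast
      linarith
  let F' : Ioi (0:ℝ) → ℝ := fun q => F q
  have hF'm : StrictMono F' := fun x y hxy => hFm x.2 y.2 hxy
  have hF's : Function.Surjective F' := by
    intro y
    obtain ⟨n, hn⟩ := exists_nat_gt ((y - F 1) / c)
    obtain ⟨m, hm⟩ := exists_nat_gt ((F 1 - y) / c)
    rw [div_lt_iff₀ hc] at hn hm
    obtain ⟨p, hp, hp'⟩ := hlow m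
    obtain ⟨q, hq, hq'⟩ := hup n
    have hpq : uIcc p q ⊆ Ioi 0 := fun x hx => lt_of_lt_of_le (lt_min hp hq) hx.1
    have := intermediate_value_uIcc (hFc.mono hpq)
    obtain ⟨z, hz, hzy⟩ := this (show y ∈ uIcc (F p) (F q) from
      Icc_subset_uIcc ⟨by linarith, by linarith⟩)
    exact ⟨⟨z, hpq hz⟩, hzy⟩
  let e : Ioi (0:ℝ) ≃o ℝ := hF'm.orderIsoOfSurjective F' hF's
  refine ⟨F, fun y => (e.symm y : ℝ), hd, hFm, fun y => (e.symm y).2, ?_, ?_, ?_, ?_, hj,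
    fun a ha => ⟨hαp a ha, hαlt a ha⟩⟩
  · intro y; exact e.apply_symm_apply y
  · intro q hq
    exact congrArg Subtype.val (e.symm_apply_apply ⟨q, hq⟩)
  · exact continuous_subtype_val.comp e.symm.continuous
  · intro x y h; exact e.symm.strictMono h

/-- The flow comparison on a closed interval with the differential inequality also at the
left endpoint. -/
lemma flow_aux (φ F E w : ℝ → ℝ) (hφ : ∀ q, 0 < q → 0 < φ q)
    (hd : ∀ q, 0 < q → HasDerivAt F (φ q)⁻¹ q)
    (hFm : StrictMonoOn F (Ioi 0)) (hE : ∀ y, 0 < E y) (hFE : ∀ y, F (E y) = y)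
    (hEF : ∀ q, 0 < q → E (F q) = q) (hEc : Continuous E)
    (ε : ℝ) (hε : 0 < ε) (a b : ℝ) (hab : a ≤ b) (hw : ContinuousOn w (Icc a b))
    (hwd : ∀ t ∈ Ico a b, ε ≤ w t → DiniUpper w t ≤ ((φ (w t) : ℝ) : EReal)) :
    F (max (w b) ε) ≤ F (max (w a) ε) + (b - a) := by
  have hmp : ∀ t, 0 < max (w t) ε := fun t => lt_max_of_lt_right hε
  have hEd : ∀ y, HasDerivAt E (φ (E y)) y := by
    intro y
    have := HasDerivAt.of_local_left_inverse (f := F) (g := E) (a := y) hEc.continuousAt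
      (hd (E y) (hE y)) (inv_ne_zero (hφ _ (hE y)).ne') (Eventually.of_forall hFE)
    simpa using this
  have key : ∀ κ : ℝ, 0 < κ → F (max (w b) ε) ≤ F (max (w a) ε) + (1 + κ) * (b - a) := by
    intro κ hκ
    set B : ℝ → ℝ := fun t => E (F (max (w a) ε) + (1 + κ) * (t - a)) with hB
    have hBd : ∀ t, HasDerivAt B (φ (B t) * (1 + κ)) t := by
      intro t
      have h1 : HasDerivAt (fun t => F (max (w a) ε) + (1 + κ) * (t - a)) (1 + κ) t := by
        simpa using (((hasDerivAt_id t).sub_const a).const_mul (1 + κ)).const_add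
          (F (max (w a) ε))
      exact (hEd _).comp t h1
    have hle : max (w b) ε ≤ B b := by
      refine image_le_of_liminf_slope_right_lt_deriv_boundary (f := fun t => max (w t) ε)
        (f' := fun t => φ (max (w t) ε)) (B := B) (B' := fun t => φ (B t) * (1 + κ))
        (a := a) (b := b)
        (hw.sup continuousOn_const) ?_ ?_ hBd ?_ ⟨hab, le_rfl⟩
      · intro x hx r hr
        have hr0 : 0 < r := (hφ _ (hmp x)).trans hr
        apply Eventually.frequently
        have hwr : Tendsto w (𝓝[>] x) (𝓝 (w x)) := by
          have h1 : ContinuousWithinAt w (Icc a b) x := hw x ⟨hx.1, hx.2.le⟩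
          have h2 : 𝓝[>] x ≤ 𝓝[Icc a b] x := by
            apply le_inf inf_le_left
            rw [le_principal_iff]
            exact mem_of_superset (Ioo_mem_nhdsGT hx.2) (fun z hz =>
              ⟨hx.1.trans hz.1.le, hz.2.le⟩)
          exact h1.tendsto.mono_left h2
        rcases lt_or_ge (w x) ε with hlt | hge
        · filter_upwards [hwr.eventually (gt_mem_nhds hlt)] with z hz
          simp [slope_def_field, max_eq_right hz.le, max_eq_right hlt.le, hr0]
        · rw [max_eq_left hge] at hr
          have h1 := hwd x hx hge
          have h2 : DiniUpper w x < (r : EReal) := lt_of_le_of_lt h1 (by exact_mod_cast hr)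
          have h3 := eventually_lt_of_limsup_lt h2
          have h4 : Tendsto (fun z => z - x) (𝓝[>] x) (𝓝[>] 0) := by
            apply tendsto_nhdsWithin_iff.2
            constructor
            · have : Tendsto (fun z => z - x) (𝓝 x) (𝓝 (x - x)) :=
                (continuous_id.sub continuous_const).tendsto x
              rw [sub_self] at this
              exact this.mono_left inf_le_left
            · filter_upwards [self_mem_nhdsWithin] with z hz
              exact mem_Ioi.2 (sub_pos.2 (mem_Ioi.1 hz))
          filter_upwards [h4.eventually h3, self_mem_nhdsWithin] with z hz hxz
          have hxz' : 0 < z - x := sub_pos.2 hxz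
          have hz' : (w (x + (z - x)) - w x) / (z - x) < r := by exact_mod_cast hz
          rw [add_sub_cancel, div_lt_iff₀ hxz'] at hz'
          rw [slope_def_field, div_lt_iff₀ hxz', max_eq_left hge]
          have : 0 < r * (z - x) := mul_pos hr0 hxz'
          rcases max_cases (w z) ε with h | h <;> linarith
      · simp [hB, hEF _ (hmp a)]
      · intro x hx h
        have : 0 < φ (max (w x) ε) := hφ _ (hmp x)
        rw [← h]
        nlinarith
    have := hFm.monotoneOn (hmp b) (hE _) hle
    rwa [hFE] at this
  have ht : Tendsto (fun κ : ℝ => F (max (w a) ε) + (1 + κ) * (b - a)) (𝓝[>] 0)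
      (𝓝 (F (max (w a) ε) + (1 + 0) * (b - a))) := by
    apply Tendsto.mono_left _ inf_le_left
    exact Continuous.tendsto (by fun_prop) 0
  have := ge_of_tendsto ht (by filter_upwards [self_mem_nhdsWithin] with κ hκ using key κ hκ)
  linarith

/-- The flow comparison with the differential inequality in the open interval only. -/
lemma flow_aux' (φ F E w : ℝ → ℝ) (hφ : ∀ q, 0 < q → 0 < φ q)
    (hd : ∀ q, 0 < q → HasDerivAt F (φ q)⁻¹ q)
    (hFm : StrictMonoOn F (Ioi 0)) (hE : ∀ y, 0 < E y) (hFE : ∀ y, F (E y) = y)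
    (hEF : ∀ q, 0 < q → E (F q) = q) (hEc : Continuous E)
    (ε : ℝ) (hε : 0 < ε) (a b : ℝ) (hab : a ≤ b) (hw : ContinuousOn w (Icc a b))
    (hwd : ∀ t ∈ Ioo a b, ε ≤ w t → DiniUpper w t ≤ ((φ (w t) : ℝ) : EReal)) :
    F (max (w b) ε) ≤ F (max (w a) ε) + (b - a) := by
  rcases hab.eq_or_lt with rfl | hlt
  · simp
  have hwr : Tendsto w (𝓝[>] a) (𝓝 (w a)) := by
    have h1 : ContinuousWithinAt w (Icc a b) a := hw a ⟨le_rfl, hab⟩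
    have h2 : 𝓝[>] a ≤ 𝓝[Icc a b] a := by
      apply le_inf inf_le_left
      rw [le_principal_iff]
      exact mem_of_superset (Ioo_mem_nhdsGT hlt) (fun z hz => ⟨hz.1.le, hz.2.le⟩)
    exact h1.tendsto.mono_left h2
  have hFt : Tendsto (fun z => F (max (w z) ε) + (b - z)) (𝓝[>] a)
      (𝓝 (F (max (w a) ε) + (b - a))) := by
    apply Tendsto.add
    · exact (hd _ (lt_max_of_lt_right hε)).continuousAt.tendsto.comp
        (hwr.max tendsto_const_nhds)
    · exact (Continuous.tendsto (by fun_prop) a).mono_left inf_le_left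
  refine ge_of_tendsto hFt ?_
  filter_upwards [Ioo_mem_nhdsGT hlt] with z hz
  exact flow_aux φ F E w hφ hd hFm hE hFE hEF hEc ε hε z b hz.2.le
    (hw.mono (Icc_subset_Icc_left hz.1.le))
    (fun t ht => hwd t ⟨hz.1.trans_le ht.1, ht.2⟩)

lemma phi_aux (F E : ℝ → ℝ) (hFm : StrictMonoOn F (Ioi 0)) (hE : ∀ y, 0 < E y)
    (hFE : ∀ y, F (E y) = y) (hEF : ∀ q, 0 < q → E (F q) = q) (hEm : StrictMono E) (s : ℝ) :
    ClassKInf (fun q => if q ≤ 0 then q else E (F q + s)) := by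
  set Φ : ℝ → ℝ := fun q => if q ≤ 0 then q else E (F q + s) with hΦ
  have hneg : ∀ q, q ≤ 0 → Φ q = q := fun q hq => by simp [hΦ, hq]
  have hpos : ∀ q, 0 < q → Φ q = E (F q + s) := fun q hq => by simp [hΦ, hq.not_ge]
  have hm : StrictMono Φ := by
    intro x y hxy
    rcases le_or_gt y 0 with hy | hy
    · rwa [hneg x (hxy.le.trans hy), hneg y hy]
    · rw [hpos y hy]
      rcases le_or_gt x 0 with hx | hx
      · rw [hneg x hx]; exact hx.trans_lt (hE _)
      · rw [hpos x hx]
        exact hEm (by linarith [hFm hx hy hxy])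
  have hs : Function.Surjective Φ := by
    intro y
    rcases le_or_gt y 0 with hy | hy
    · exact ⟨y, hneg y hy⟩
    · refine ⟨E (F y - s), ?_⟩
      rw [hpos _ (hE _), hFE, sub_add_cancel, hEF y hy]
  let e : ℝ ≃o ℝ := hm.orderIsoOfSurjective Φ hs
  exact ⟨⟨e.continuous.continuousOn, hm.strictMonoOn _, hneg 0 le_rfl⟩, e.tendsto_atTop⟩

lemma classKInf_comp {f g : ℝ → ℝ} (hf : ClassKInf f) (hg : ClassKInf g) :
    ClassKInf (fun x => f (g x)) := by
  have hn : MapsTo g (Ici 0) (Ici 0) := by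
    intro x hx
    have := hg.1.2.1.monotoneOn self_mem_Ici hx hx
    rwa [hg.1.2.2] at this
  refine ⟨⟨hf.1.1.comp hg.1.1 hn, hf.1.2.1.comp hg.1.2.1 hn, ?_⟩, hf.2.comp hg.2⟩
  simp only [hg.1.2.2, hf.1.2.2]

lemma traj_aux (φ F E w α : ℝ → ℝ) (hφ : ∀ q, 0 < q → 0 < φ q)
    (hd : ∀ q, 0 < q → HasDerivAt F (φ q)⁻¹ q)
    (hFm : StrictMonoOn F (Ioi 0)) (hE : ∀ y, 0 < E y) (hFE : ∀ y, F (E y) = y)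
    (hEF : ∀ q, 0 < q → E (F q) = q) (hEc : Continuous E)
    (θ δ : ℝ) (hθ : 0 < θ) (hδ : 0 < δ)
    (hj : ∀ a, 0 < a → F (α a) + (θ + δ) ≤ F a)
    (hα : ∀ a, 0 < a → 0 < α a ∧ α a < a) (hα0 : α 0 = 0)
    (ε : ℝ) (hε : 0 < ε) (c p : ℝ) (hcε : c ≤ ε) (hpε : p ≤ ε)
    (t₀ : ℝ) (τ : ℕ → ℝ) (hτ : IsImpulseSeq t₀ τ) (hgap : ∀ i : ℕ, τ (i + 1) - τ i ≤ θ)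
    (hw0 : ∀ t, 0 ≤ w t)
    (hreg : ImpulsiveRegular t₀ τ w)
    (hflow : ∀ t, t₀ ≤ t → t ∉ impulseSet τ → c ≤ w t →
        DiniUpper w t ≤ ((φ (w t) : ℝ) : EReal))
    (hjump : ∀ i : ℕ, 1 ≤ i → c ≤ Function.leftLim w (τ i) →
        w (τ i) ≤ α (Function.leftLim w (τ i)))
    (hjump' : ∀ i : ℕ, 1 ≤ i → Function.leftLim w (τ i) < c → w (τ i) ≤ p)
    (t : ℝ) (ht : t₀ ≤ t) :
    F (max (w t) ε) ≤ max (F (max (w t₀) ε) - δ / θ * (t - t₀) + δ) (F ε) + θ := by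
  obtain ⟨h0, hmono, htop⟩ := hτ
  obtain ⟨hrc, hcont, hleft⟩ := hreg
  have hτ0 : ∀ i, t₀ ≤ τ i := fun i => by rw [← h0]; exact hmono.monotone (Nat.zero_le i)
  have hnot : ∀ i t, τ i < t → t < τ (i + 1) → t ∉ impulseSet τ := by
    rintro i t h1 h2 ⟨j, -, rfl⟩
    have := hmono.lt_iff_lt.1 h1
    have := hmono.lt_iff_lt.1 h2
    omega
  have hmp : ∀ z : ℝ, 0 < max z ε := fun z => lt_max_of_lt_right hε
  have hseg : ∀ i t, τ i ≤ t → t < τ (i + 1) →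
      F (max (w t) ε) ≤ F (max (w (τ i)) ε) + (t - τ i) := by
    intro i t h1 h2
    refine flow_aux' φ F E w hφ hd hFm hE hFE hEF hEc ε hε (τ i) t h1 ?_ ?_
    · intro z hz
      rcases hz.1.eq_or_lt with h | h
      · subst h
        exact (hrc _ (hτ0 i)).mono Icc_subset_Ici_self
      · exact (hcont z ((hτ0 i).trans hz.1) (hnot i z h (hz.2.trans_lt h2))).mono
          (fun y hy => (hτ0 i).trans hy.1)
    · intro z hz hez
      exact hflow z ((hτ0 i).trans hz.1.le) (hnot i z hz.1 (hz.2.trans h2)) (hcε.trans hez)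
  have hmaxF : ∀ z b : ℝ, z ≤ b → 0 < b → F (max z ε) ≤ max (F b) (F ε) := by
    intro z b hzb hb
    rcases max_cases z ε with h | h
    · rw [h.1]
      exact le_max_of_le_left (hFm.monotoneOn (hε.trans_le h.2) hb hzb)
    · rw [h.1]; exact le_max_right _ _
  have hstep : ∀ i, F (max (w (τ (i + 1))) ε) ≤ max (F (max (w (τ i)) ε) - δ) (F ε) := by
    intro i
    obtain ⟨L, hL⟩ := hleft (i + 1) (by omega)
    have hLeq : Function.leftLim w (τ (i + 1)) = L := leftLim_eq_of_tendsto hL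
    have hL0 : 0 ≤ L := ge_of_tendsto hL (Eventually.of_forall hw0)
    have hFL : F (max L ε) ≤ F (max (w (τ i)) ε) + θ := by
      have h1 : Tendsto (fun t => F (max (w t) ε)) (𝓝[<] (τ (i + 1))) (𝓝 (F (max L ε))) :=
        (hd _ (hmp L)).continuousAt.tendsto.comp (hL.max tendsto_const_nhds)
      refine le_of_tendsto h1 ?_
      filter_upwards [Ioo_mem_nhdsLT (hmono (Nat.lt_succ_self i))] with z hz
      have := hseg i z hz.1.le hz.2
      have := hgap i
      have := hz.2
      linarith
    have hj1 := hjump (i + 1) (by omega)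
    have hj2 := hjump' (i + 1) (by omega)
    rw [hLeq] at hj1 hj2
    rcases lt_or_ge ε L with h | h
    · have hLp : 0 < L := hε.trans h
      have h1 := hj1 (hcε.trans h.le)
      have h2 := hmaxF _ _ h1 (hα L hLp).1
      rw [max_eq_left h.le] at hFL
      have h3 := hj L hLp
      exact h2.trans (max_le_max_right _ (by linarith))
    · have : w (τ (i + 1)) ≤ ε := by
        rcases lt_or_ge L c with h' | h'
        · exact (hj2 h').trans hpε
        · refine (hj1 h').trans ?_
          rcases hL0.eq_or_lt with h0 | h0
          · rw [← h0, hα0]; exact hε.le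
          · exact (hα L h0).2.le.trans h
      rw [max_eq_right this]
      exact le_max_right _ _
  have hind : ∀ i : ℕ, F (max (w (τ i)) ε) ≤ max (F (max (w t₀) ε) - i * δ) (F ε) := by
    intro i
    induction i with
    | zero => rw [h0]; simp
    | succ i ih =>
      refine (hstep i).trans (max_le ?_ (le_max_right _ _))
      push_cast
      rcases le_max_iff.1 ih with h | h
      · apply le_max_of_le_left; linarith
      · apply le_max_of_le_right; linarith
  have hlen : ∀ i : ℕ, τ i - t₀ ≤ i * θ := by
    intro i
    induction i with
    | zero => simp [h0]
    | succ i ih => have := hgap i; push_cast; linarith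
  obtain ⟨i, hi1, hi2⟩ : ∃ i, τ i ≤ t ∧ t < τ (i + 1) := by
    have hex : ∃ n, t < τ n := (htop.eventually_gt_atTop t).exists
    classical
    have hsp := Nat.find_spec hex
    rcases hn : Nat.find hex with _ | n
    · rw [hn, h0] at hsp; linarith
    · rw [hn] at hsp
      refine ⟨n, ?_, hsp⟩
      exact not_lt.1 (Nat.find_min hex (by omega))
  have h1 := hseg i t hi1 hi2
  have h2 := hgap i
  have h3 := hind i
  have h4 : δ / θ * (t - t₀) ≤ i * δ + δ := by
    have h5 := hlen (i + 1)
    push_cast at h5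
    rw [div_mul_eq_mul_div, div_le_iff₀ hθ]
    nlinarith
  have h6 : max (F (max (w t₀) ε) - i * δ) (F ε) ≤
      max (F (max (w t₀) ε) - δ / θ * (t - t₀) + δ) (F ε) :=
    max_le_max_right _ (by linarith)
  linarith


/-- dwell-time ISS theorem for unstable flows and stable jumps
(trajectory-wise): `−ρ ∈ 𝒫`, `∫₀¹ ds/(−ρ(s)) = ∞`, jump condition
`∫_{α(a)}^a ds/(−ρ(s)) ≥ θ + δ`, and impulse gaps `≤ θ` yield the ISS estimate. -/
theorem dwellTimeISSUnstableFlow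
    (ψ₁ ψ₂ η : ℝ → ℝ) (hψ₁ : ClassKInf ψ₁) (hψ₂ : ClassKInf ψ₂) (hη : ClassKInf η)
    (ψ₃ : ℝ → ℝ) (hψ₃ : ClassK ψ₃)
    (ρ : ℝ → ℝ) (hρ : ClassP (fun s => -ρ s))
    (hdiv : ∫⁻ s in Set.Ioc (0:ℝ) 1, ENNReal.ofReal ((-ρ s)⁻¹) = ⊤)
    (α : ℝ → ℝ) (hα : ClassKInf α)
    (θ δ : ℝ) (hθ : 0 < θ) (hδ : 0 < δ)
    (hjumpint : ∀ a, 0 < a → θ + δ ≤ ∫ s in (α a)..a, (-ρ s)⁻¹) :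
    ∃ β : ℝ → ℝ → ℝ, ∃ γ : ℝ → ℝ, ClassKL β ∧ ClassKInf γ ∧
      ∀ (X : Type u) [NormedAddCommGroup X] [NormedSpace ℝ X],
      ∀ (t₀ : ℝ) (τ : ℕ → ℝ), IsImpulseSeq t₀ τ →
      (∀ i : ℕ, τ (i + 1) - τ i ≤ θ) →
      ∀ r : ℝ, 0 ≤ r →
      ∀ Vc : X → ℝ, Continuous Vc →
      (∀ y : X, ψ₁ ‖y‖ ≤ Vc y ∧ Vc y ≤ ψ₂ ‖y‖) →
      ∀ x : ℝ → X,
      ImpulsiveRegular t₀ τ (fun t => Vc (x t)) →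
      (∀ t, t₀ ≤ t → t ∉ impulseSet τ → η r ≤ Vc (x t) →
        DiniUpper (fun s => Vc (x s)) t ≤ (((-ρ (Vc (x t))) : ℝ) : EReal)) →
      (∀ i : ℕ, 1 ≤ i → η r ≤ Function.leftLim (fun s => Vc (x s)) (τ i) →
        Vc (x (τ i)) ≤ α (Function.leftLim (fun s => Vc (x s)) (τ i))) →
      (∀ i : ℕ, 1 ≤ i → Function.leftLim (fun s => Vc (x s)) (τ i) < η r →
        Vc (x (τ i)) ≤ ψ₃ r) →
      ∀ t, t₀ ≤ t → ‖x t‖ ≤ β ‖x t₀‖ (t - t₀) + γ r := by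
  obtain ⟨F, E, hd, hFm, hE, hFE, hEF, hEc, hEm, hj, hαp⟩ :=
    exists_F_aux ρ hρ α hα (θ + δ) (by linarith) hjumpint
  obtain ⟨χ, hχ, hχl, hχr, hχn⟩ := exists_inv_aux ψ₁ hψ₁
  have hΦ := phi_aux F E hFm hE hFE hEF hEm
  set Φ : ℝ → ℝ → ℝ := fun s q => if q ≤ 0 then q else E (F q + s) with hΦdef
  have hΦK : ∀ s, ClassKInf (Φ s) := hΦ
  have hΦpos : ∀ s q, 0 < q → Φ s q = E (F q + s) := fun s q hq => by
    simp [hΦdef, hq.not_ge]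
  have hΦ0 : ∀ s, Φ s 0 = 0 := fun s => (hΦK s).1.2.2
  have nn : ∀ g, ClassKInf g → ∀ q, 0 ≤ q → 0 ≤ g q := by
    intro g hg q hq
    have := hg.1.2.1.monotoneOn self_mem_Ici hq hq
    rwa [hg.1.2.2] at this
  have hE0 : Tendsto E atBot (𝓝 0) := by
    rw [Metric.tendsto_nhds]
    intro e he
    filter_upwards [eventually_le_atBot (F (e / 2))] with y hy
    have h1 := hEm.monotone hy
    rw [hEF _ (half_pos he)] at h1
    rw [Real.dist_eq, sub_zero, abs_of_pos (hE y)]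
    linarith
  have hsum : ClassKInf (fun r => η r + ψ₃ r) := by
    have h3 : ∀ r, 0 ≤ r → 0 ≤ ψ₃ r := by
      intro r hr
      have := hψ₃.2.1.monotoneOn self_mem_Ici hr hr
      rwa [hψ₃.2.2] at this
    refine ⟨⟨hη.1.1.add hψ₃.1, fun x hx y hy h => add_lt_add (hη.1.2.1 hx hy h)
      (hψ₃.2.1 hx hy h), by simp [hη.1.2.2, hψ₃.2.2]⟩, ?_⟩
    refine tendsto_atTop_mono' _ ?_ hη.2
    filter_upwards [eventually_ge_atTop 0] with r hr
    linarith [h3 r hr]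
  refine ⟨fun q s => χ (Φ (θ + δ - δ / θ * s) (ψ₂ q)),
    fun r => χ (Φ (θ + δ) (η r + ψ₃ r)), ⟨?_, ?_⟩, ?_, ?_⟩
  · intro s hs
    exact (classKInf_comp hχ (classKInf_comp (hΦK _) hψ₂)).1
  · intro q hq
    have hq2 := nn _ hψ₂ q hq
    constructor
    · intro s hs s' hs' hss
      apply hχ.1.2.1.monotoneOn (nn _ (hΦK _) _ hq2) (nn _ (hΦK _) _ hq2)
      rcases hq2.eq_or_lt with h | h
      · rw [← h, hΦ0, hΦ0]
      · rw [hΦpos _ _ h, hΦpos _ _ h]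
        apply hEm.monotone
        have : δ / θ * s ≤ δ / θ * s' := mul_le_mul_of_nonneg_left hss (by positivity)
        linarith
    · have hχc : Tendsto χ (𝓝[≥] 0) (𝓝 0) := by
        have := hχ.1.1 0 self_mem_Ici
        unfold ContinuousWithinAt at this
        rwa [hχ.1.2.2] at this
      refine hχc.comp (tendsto_nhdsWithin_iff.2 ⟨?_, Eventually.of_forall fun s =>
        nn _ (hΦK _) _ hq2⟩)
      rcases hq2.eq_or_lt with h | h
      · simp only [← h, hΦ0]; exact tendsto_const_nhds
      · simp only [hΦpos _ _ h]
        refine hE0.comp ?_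
        apply tendsto_atBot_add_const_left
        simp only [sub_eq_add_neg]
        apply tendsto_atBot_add_const_left
        apply tendsto_neg_atTop_atBot.comp
        exact tendsto_id.const_mul_atTop (by positivity)
  · exact classKInf_comp hχ (classKInf_comp (hΦK _) hsum)
  intro X _ _ t₀ τ hτ hgap r hr Vc hVc hV x hreg hflow hjump hjump' t ht
  have hw0 : ∀ t, 0 ≤ Vc (x t) := fun t =>
    (nn _ hψ₁ _ (norm_nonneg _)).trans (hV (x t)).1
  have hψ₃r : 0 ≤ ψ₃ r := by
    have := hψ₃.2.1.monotoneOn self_mem_Ici hr hr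
    rwa [hψ₃.2.2] at this
  have hηr := nn _ hη r hr
  set T := δ / θ * (t - t₀) with hT
  have hT0 : 0 ≤ T := mul_nonneg (by positivity) (by linarith)
  have key : ∀ ε, 0 < ε → η r + ψ₃ r ≤ ε →
      Vc (x t) ≤ max (Φ (θ + δ - T) (Vc (x t₀))) (Φ (θ + δ) ε) := by
    intro ε hε hle
    have h := traj_aux (fun s => -ρ s) F E (fun t => Vc (x t)) α hρ.2.2 hd hFm hE hFE hEF hEc
      θ δ hθ hδ hj hαp hα.1.2.2 ε hε (η r) (ψ₃ r) (by linarith) (by linarith) t₀ τ hτ hgap hw0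
      hreg hflow hjump hjump' t ht
    have hmp : ∀ z : ℝ, 0 < max z ε := fun z => lt_max_of_lt_right hε
    have h2 : F (max (Vc (x t)) ε) ≤
        max (F (max (Vc (x t₀)) ε) + (θ + δ - T)) (F ε + (θ + δ)) := by
      rcases le_max_iff.1 (sub_le_iff_le_add.2 h) with h | h
      · apply le_max_of_le_left; linarith
      · apply le_max_of_le_right; linarith
    have h3 : max (Vc (x t)) ε ≤ E (max (F (max (Vc (x t₀)) ε) + (θ + δ - T)) (F ε + (θ + δ))) := by
      have := hEm.monotone h2
      rwa [hEF _ (hmp _)] at this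
    refine (le_max_left _ _).trans (h3.trans ?_)
    rw [hEm.monotone.map_max]
    apply max_le
    · rcases le_total ε (Vc (x t₀)) with h | h
      · apply le_max_of_le_left
        rw [max_eq_left h, hΦpos _ _ (hε.trans_le h)]
      · apply le_max_of_le_right
        rw [max_eq_right h, hΦpos _ _ hε]
        exact hEm.monotone (by linarith)
    · apply le_max_of_le_right
      rw [hΦpos _ _ hε]
  have key2 : Vc (x t) ≤ max (Φ (θ + δ - T) (Vc (x t₀))) (Φ (θ + δ) (η r + ψ₃ r)) := by
    have hnn : 0 ≤ η r + ψ₃ r := by linarith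
    have hc : Tendsto (Φ (θ + δ)) (𝓝[>] (η r + ψ₃ r)) (𝓝 (Φ (θ + δ) (η r + ψ₃ r))) :=
      ((hΦK (θ + δ)).1.1 _ hnn).tendsto.mono_left
        (nhdsWithin_mono _ (fun y hy => hnn.trans (le_of_lt hy)))
    refine ge_of_tendsto (tendsto_const_nhds.max hc) ?_
    filter_upwards [self_mem_nhdsWithin] with ε hε
    exact key ε (hnn.trans_lt hε) (le_of_lt hε)
  have hnn : 0 ≤ η r + ψ₃ r := by linarith
  have hA : 0 ≤ Φ (θ + δ - T) (ψ₂ ‖x t₀‖) := nn _ (hΦK _) _ (nn _ hψ₂ _ (norm_nonneg _))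
  have hB : 0 ≤ Φ (θ + δ) (η r + ψ₃ r) := nn _ (hΦK _) _ hnn
  have key3 : ψ₁ ‖x t‖ ≤ max (Φ (θ + δ - T) (ψ₂ ‖x t₀‖)) (Φ (θ + δ) (η r + ψ₃ r)) := by
    refine (hV (x t)).1.trans (key2.trans (max_le_max_right _ ?_))
    exact (hΦK _).1.2.1.monotoneOn (hw0 t₀) (nn _ hψ₂ _ (norm_nonneg _)) (hV (x t₀)).2
  have key4 : ‖x t‖ ≤ χ (max (Φ (θ + δ - T) (ψ₂ ‖x t₀‖)) (Φ (θ + δ) (η r + ψ₃ r))) := by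
    have := hχ.1.2.1.monotoneOn (nn _ hψ₁ _ (norm_nonneg (x t))) (mem_Ici.2 (le_max_of_le_left hA)) key3
    rwa [hχl _ (norm_nonneg _)] at this
  have hA' := hχn _ hA
  have hB' := hχn _ hB
  refine key4.trans ?_
  show _ ≤ χ (Φ (θ + δ - T) (ψ₂ ‖x t₀‖)) + χ (Φ (θ + δ) (η r + ψ₃ r))
  rcases max_cases (Φ (θ + δ - T) (ψ₂ ‖x t₀‖)) (Φ (θ + δ) (η r + ψ₃ r)) with h | h <;>
    rw [h.1] <;> linarith
end
end
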